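/- For every integer n ≥ 5, the tree DC(⌊(n-3)/2⌋, ⌈(n-3)/2⌉, 3) is the unique maximizer of λ₁(T) + λ₂(T) among all trees T on n vertices; that is, every tree T on n vertices not isomorphic to DC(⌊(n-3)/2⌋, ⌈(n-3)/2⌉, 3) satisfies λ₁(T) + λ₂(T) < λ₁(DC(⌊(n-3)/2⌋, ⌈(n-3)/2⌉, 3)) + λ₂(DC(⌊(n-3)/2⌋, ⌈(n-3)/2⌉, 3)). -/

import Mathlib

open scoped Classical

/-- Adjacency matrix of a simple graph on `Fin n`, over `ℝ`. -/
noncomputable def adjMat {n : ℕ} (G : SimpleGraph (Fin n)) : Matrix (Fin n) (Fin n) ℝ :=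
  fun i j => if G.Adj i j then 1 else 0

/-- The eigenvalues (roots of the characteristic polynomial, with multiplicity)
of the adjacency matrix, sorted in nondecreasing order. -/
noncomputable def eigList {n : ℕ} (G : SimpleGraph (Fin n)) : List ℝ :=
  (Matrix.charpoly (adjMat G)).roots.sort (· ≤ ·)

/-- `lam k G` is the `k`-th largest adjacency eigenvalue of `G` (so `lam 1` is `λ₁`). -/
noncomputable def lam {n : ℕ} (k : ℕ) (G : SimpleGraph (Fin n)) : ℝ :=
  (eigList G).getD (n - k) 0

/-- The double comet `DC(k1, k2, l)`: a path on `l` vertices (the vertices `0, …, l-1`),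
with `k1` pendant leaves attached to the terminal vertex `0` and `k2` pendant leaves
attached to the terminal vertex `l - 1`. -/
def doubleComet (k1 k2 l : ℕ) : SimpleGraph (Fin (k1 + k2 + l)) :=
  SimpleGraph.fromRel (fun i j =>
    ((i : ℕ) + 1 = (j : ℕ) ∧ (j : ℕ) < l) ∨
    (l ≤ (i : ℕ) ∧ (i : ℕ) < l + k1 ∧ (j : ℕ) = 0) ∨
    (l + k1 ≤ (i : ℕ) ∧ (j : ℕ) = l - 1))

/-- Degree of a vertex. -/
noncomputable def deg {n : ℕ} (G : SimpleGraph (Fin n)) (u : Fin n) : ℕ :=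
  (Finset.univ.filter (fun w => G.Adj u w)).card

lemma adjMat_herm {n : ℕ} (G : SimpleGraph (Fin n)) : (adjMat G).IsHermitian := by
  ext i j
  simp [adjMat, Matrix.conjTranspose_apply, G.adj_comm]

lemma roots_eq {n : ℕ} (G : SimpleGraph (Fin n)) :
    (Matrix.charpoly (adjMat G)).roots = Multiset.map (adjMat_herm G).eigenvalues Finset.univ.val := by
  have := (adjMat_herm G).roots_charpoly_eq_eigenvalues
  simpa using this

lemma roots_card {n : ℕ} (G : SimpleGraph (Fin n)) :
    (Matrix.charpoly (adjMat G)).roots.card = n := by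
  rw [roots_eq]; simp

lemma roots_neg {n : ℕ} (G : SimpleGraph (Fin n)) (s : Fin n → ℝ) (hs : ∀ i, s i * s i = 1)
    (hG : ∀ i j, G.Adj i j → s i = - s j) :
    (Matrix.charpoly (adjMat G)).roots.map (fun x => -x) = (Matrix.charpoly (adjMat G)).roots := by
  have h1 : Matrix.diagonal s * adjMat G * Matrix.diagonal s = - adjMat G := by
    ext i j
    simp only [Matrix.mul_diagonal, Matrix.diagonal_mul, adjMat, Matrix.neg_apply]
    by_cases h : G.Adj i j
    · have := hG i j h
      have := hs j
      simp only [h, if_true, this]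
      rw [‹s i = - s j›]; linarith
    · simp [h]
  have h2 : Matrix.diagonal s * Matrix.diagonal s = 1 := by
    rw [Matrix.diagonal_mul_diagonal]; simp [hs]
  have h3 : (- adjMat G).charpoly = (adjMat G).charpoly := by
    rw [← h1, Matrix.charpoly_mul_comm, ← mul_assoc, h2, one_mul]
  have h4 : (-adjMat G).charpoly = ∏ i, (Polynomial.X - Polynomial.C (-(adjMat_herm G).eigenvalues i)) := by
    apply Polynomial.funext
    intro t
    have h5 : Matrix.scalar (Fin n) t - (-adjMat G) = -(Matrix.scalar (Fin n) (-t) - adjMat G) := by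
      rw [map_neg]; abel
    rw [Matrix.eval_charpoly, h5, Matrix.det_neg, ← Matrix.eval_charpoly, (adjMat_herm G).charpoly_eq,
      Polynomial.eval_prod, Polynomial.eval_prod, ← Finset.card_univ, ← Finset.prod_const, ← Finset.prod_mul_distrib]
    apply Finset.prod_congr rfl
    intro i _
    simp
    ring
  have h6 : (-adjMat G).charpoly.roots = Multiset.map (fun i => -(adjMat_herm G).eigenvalues i) Finset.univ.val := by
    rw [h4]
    exact Polynomial.roots_multiset_prod_X_sub_C (Multiset.map (fun i => -(adjMat_herm G).eigenvalues i) Finset.univ.val) ▸ by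
      rw [Multiset.map_map]; rfl
  rw [h3] at h6
  conv_rhs => rw [h6]
  rw [roots_eq, Multiset.map_map]; rfl

lemma spec {n : ℕ} (hn : 4 ≤ n) (G : SimpleGraph (Fin n)) 
    (hR : (Matrix.charpoly (adjMat G)).roots.map (fun x => -x) = (Matrix.charpoly (adjMat G)).roots) :
    ∃ M : Multiset ℝ, (Matrix.charpoly (adjMat G)).roots =
      {-lam 1 G, -lam 2 G, lam 2 G, lam 1 G} + M ∧ lam 2 G ≤ lam 1 G ∧ 0 ≤ lam 2 G ∧
      ∀ m ∈ M, |m| ≤ lam 2 G := by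
  set R := (Matrix.charpoly (adjMat G)).roots with hRd
  have hL : ((eigList G : List ℝ) : Multiset ℝ) = R := by
    simp [eigList, hRd]
  have hlen : (eigList G).length = n := by
    have := congrArg Multiset.card hL
    simpa [hRd, roots_card] using this
  have hsort : (eigList G).Pairwise (· ≤ ·) := Multiset.pairwise_sort _ _
  have hrev : ((eigList G).map (fun x => -x)).reverse = eigList G := by
    apply List.Perm.eq_of_pairwise (le := (· ≤ ·))
    · intros; linarith
    · rw [List.pairwise_reverse, List.pairwise_map]
      exact hsort.imp (by intros; linarith)
    · exact hsort
    · rw [← Multiset.coe_eq_coe, Multiset.coe_reverse, ← Multiset.map_coe, hL, hR]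
  have l1 : lam 1 G = (eigList G).getD (n-1) 0 := rfl
  have l2 : lam 2 G = (eigList G).getD (n-2) 0 := rfl
  rw [← hL, l1, l2]
  generalize eigList G = L at *
  obtain _ | ⟨a, _ | ⟨b, L⟩⟩ := L
  · simp at hlen; omega
  · simp at hlen; omega
  obtain rfl | ⟨L, d, rfl⟩ := L.eq_nil_or_concat
  · simp at hlen; omega
  obtain rfl | ⟨L, c, rfl⟩ := L.eq_nil_or_concat
  · simp at hlen; omega
  simp only [List.concat_eq_append, List.append_assoc, List.cons_append, List.nil_append, List.length_cons, List.length_append, List.length_nil] at *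
  have e1 : n - 1 = L.length + 3 := by omega
  have e2 : n - 2 = L.length + 2 := by omega
  have g1 : (a :: b :: (L ++ [c, d])).getD (n-1) 0 = d := by
    rw [e1]; simp
  have g2 : (a :: b :: (L ++ [c, d])).getD (n-2) 0 = c := by
    rw [e2]; simp
  rw [g1, g2]
  simp only [List.map_cons, List.map_append, List.reverse_cons, List.reverse_append, List.map_nil, List.reverse_nil, List.nil_append, List.append_assoc, List.cons_append, List.cons.injEq] at hrev
  obtain ⟨ha, hb, -⟩ := hrev
  refine ⟨L, ?_, ?_, ?_, ?_⟩
  · rw [ha, hb]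
    simp only [← Multiset.cons_coe, ← Multiset.coe_add, Multiset.insert_eq_cons, ← Multiset.singleton_add, ← Multiset.coe_nil]
    simp only [Multiset.coe_nil]
    abel
  all_goals
    simp only [List.pairwise_cons, List.pairwise_append, List.mem_append, List.mem_cons, List.not_mem_nil] at hsort
  · grind
  · have : b ≤ c := hsort.2.1 c (by simp)
    linarith
  · intro m hm
    have hm' : m ∈ L := by simpa using hm
    have h1 : b ≤ m := hsort.2.1 m (by simp [hm'])
    have h2 : m ≤ c := hsort.2.2.2.2 m hm' c (by simp)
    rw [abs_le]; constructor <;> linarith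


lemma trace_pow_eq {n : ℕ} (G : SimpleGraph (Fin n)) (k : ℕ) :
    ((Matrix.charpoly (adjMat G)).roots.map (fun x => x ^ k)).sum = (adjMat G ^ k).trace := by
  rw [roots_eq, Multiset.map_map]
  conv_rhs => rw [(adjMat_herm G).spectral_theorem, ← map_pow, Unitary.conjStarAlgAut_apply,
    Matrix.trace_mul_comm, ← mul_assoc]
  simp [Matrix.diagonal_pow, Matrix.trace_diagonal, List.sum_ofFn]

lemma count_eig {n m : ℕ} (G : SimpleGraph (Fin n)) (c : ℝ) (e : Fin m → Fin n)
    (he : Function.Injective e)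
    (h : ∀ w : Fin m → ℝ, c * ∑ i, w i ^ 2 ≤ ∑ i, (∑ j, adjMat G (e i) (e j) * w j) ^ 2) :
    m ≤ ((Matrix.charpoly (adjMat G)).roots.filter (fun x => c ≤ x ^ 2)).card := by
  set hA := adjMat_herm G with hAd
  have hcard : ((Matrix.charpoly (adjMat G)).roots.filter (fun x => c ≤ x ^ 2)).card =
      Fintype.card {i : Fin n // c ≤ hA.eigenvalues i ^ 2} := by
    rw [roots_eq, Multiset.filter_map, Multiset.card_map, Fintype.card_subtype]
    rfl
  rw [hcard]
  by_contra hlt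
  push Not at hlt
  set F : Fin n → Fin n → ℝ := fun i k => hA.eigenvectorBasis i k with hF
  -- extension by zero
  let ext : (Fin m → ℝ) → (Fin n → ℝ) := fun w k => ∑ j, if e j = k then w j else 0
  have hext : ∀ w j, ext w (e j) = w j := by
    intro w j
    simp only [ext, he.eq_iff]
    simp
  have hextsum : ∀ w (g : Fin n → ℝ), ∑ k, g k * ext w k = ∑ j, g (e j) * w j := by
    intro w g
    simp only [ext, Finset.mul_sum]
    rw [Finset.sum_comm]
    apply Finset.sum_congr rfl
    intro j _
    simp
  have parseval : ∀ v : Fin n → ℝ, ∑ i, (∑ k, F i k * v k) ^ 2 = ∑ k, v k ^ 2 := by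
    intro v
    have := hA.eigenvectorBasis.sum_sq_norm_inner_right (WithLp.toLp 2 v)
    rw [EuclideanSpace.norm_sq_eq] at this
    simp only [Real.norm_eq_abs, sq_abs] at this
    rw [← this]
    apply Finset.sum_congr rfl
    intro i _
    congr 1
    simp [PiLp.inner_apply, hF, mul_comm]
  have heig : ∀ (v : Fin n → ℝ) i, ∑ k, F i k * (adjMat G).mulVec v k = hA.eigenvalues i * ∑ k, F i k * v k := by
    intro v i
    have h1 := hA.mulVec_eigenvectorBasis i
    have h2 : F i ⬝ᵥ (adjMat G).mulVec v = ((adjMat G).mulVec (F i)) ⬝ᵥ v := by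
      rw [Matrix.dotProduct_mulVec, ← Matrix.mulVec_transpose]
      congr 2
    have h3 : (adjMat G).mulVec (F i) = hA.eigenvalues i • F i := h1
    rw [h3, smul_dotProduct] at h2
    simpa [dotProduct] using h2
  let Φ : (Fin m → ℝ) →ₗ[ℝ] ({i : Fin n // c ≤ hA.eigenvalues i ^ 2} → ℝ) :=
    { toFun := fun w i => ∑ j, F i (e j) * w j
      map_add' := by intro x y; ext i; simp [mul_add, Finset.sum_add_distrib]
      map_smul' := by 
        intro x y; ext i; simp [Finset.mul_sum]
        apply Finset.sum_congr rfl; intros; ring }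
  have hker : LinearMap.ker Φ ≠ ⊥ := by
    apply LinearMap.ker_ne_bot_of_finrank_lt
    simpa using hlt
  obtain ⟨w, hw, hw0⟩ := (Submodule.ne_bot_iff _).1 hker
  have hw1 : ∀ i, c ≤ hA.eigenvalues i ^ 2 → ∑ k, F i k * ext w k = 0 := by
    intro i hi
    rw [hextsum]
    exact congrFun (LinearMap.mem_ker.1 hw) ⟨i, hi⟩
  have hsq : ∑ k, ext w k ^ 2 = ∑ j, w j ^ 2 := by
    have := hextsum w (ext w)
    simp only [hext] at this
    simpa [sq] using this
  have hA1 : ∑ i, (∑ j, adjMat G (e i) (e j) * w j) ^ 2 ≤ ∑ k, ((adjMat G).mulVec (ext w) k) ^ 2 := by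
    have : ∀ i, ∑ j, adjMat G (e i) (e j) * w j = (adjMat G).mulVec (ext w) (e i) := by
      intro i
      rw [← hextsum]; rfl
    simp only [this]
    rw [← Finset.sum_image (s := Finset.univ) (g := e) (f := fun k => ((adjMat G).mulVec (ext w) k) ^ 2) (he.injOn)]
    exact Finset.sum_le_sum_of_subset_of_nonneg (Finset.subset_univ _) (fun _ _ _ => sq_nonneg _)
  have hA2 : ∑ k, ((adjMat G).mulVec (ext w) k) ^ 2 < c * ∑ k, ext w k ^ 2 := by
    rw [← parseval, ← parseval (ext w), Finset.mul_sum]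
    simp only [heig]
    have hpos : 0 < ∑ i, (∑ k, F i k * ext w k) ^ 2 := by
      rw [parseval, hsq]
      apply lt_of_le_of_ne (Finset.sum_nonneg fun _ _ => sq_nonneg _)
      intro h0
      apply hw0
      ext j
      have := (Finset.sum_eq_zero_iff_of_nonneg (fun _ _ => sq_nonneg _)).1 h0.symm j (Finset.mem_univ _)
      simpa using this
    obtain ⟨i0, _, hi0⟩ := Finset.exists_lt_of_sum_lt (s := Finset.univ) (f := fun _ : Fin n => (0:ℝ)) (by simpa using hpos)
    apply Finset.sum_lt_sum
    · intro i _
      by_cases hi : c ≤ hA.eigenvalues i ^ 2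
      · rw [hw1 i hi]; simp
      · rw [mul_pow]; exact mul_le_mul_of_nonneg_right (le_of_not_ge hi) (sq_nonneg _)
    · refine ⟨i0, Finset.mem_univ _, ?_⟩
      by_cases hi : c ≤ hA.eigenvalues i0 ^ 2
      · rw [hw1 i0 hi] at hi0; simp at hi0
      · rw [mul_pow]; exact mul_lt_mul_of_pos_right (lt_of_not_ge hi) hi0
  have := h w
  rw [hsq] at hA2
  linarith


lemma sum_row {n : ℕ} (G : SimpleGraph (Fin n)) (i : Fin n) : ∑ j, adjMat G i j = (G.degree i : ℝ) := by
  simp [adjMat, SimpleGraph.neighborFinset_eq_filter, ← SimpleGraph.card_neighborFinset_eq_degree]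

lemma sum_deg {n : ℕ} (T : SimpleGraph (Fin n)) (hT : T.IsTree) :
    ∑ i, (T.degree i : ℝ) = 2 * (n - 1) := by
  have h1 := T.sum_degrees_eq_twice_card_edges
  have h2 := hT.card_edgeFinset
  rw [Fintype.card_fin] at h2
  have : (T.edgeFinset.card : ℝ) + 1 = n := by exact_mod_cast h2
  rw [← this]
  have h1' : (∑ i, (T.degree i : ℝ)) = 2 * (T.edgeFinset.card : ℝ) := by exact_mod_cast h1
  rw [h1']; ring

lemma adjMat_comm {n : ℕ} (G : SimpleGraph (Fin n)) (i j : Fin n) : adjMat G i j = adjMat G j i := by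
  simp [adjMat, G.adj_comm]

lemma sq_diag {n : ℕ} (G : SimpleGraph (Fin n)) (i : Fin n) : (adjMat G ^ 2) i i = (G.degree i : ℝ) := by
  rw [← sum_row, sq, Matrix.mul_apply]
  apply Finset.sum_congr rfl
  intro j _
  rw [adjMat_comm G j i]
  simp [adjMat]

lemma sq_nat {n : ℕ} (G : SimpleGraph (Fin n)) (i j : Fin n) : ∃ k : ℕ, (adjMat G ^ 2) i j = k := by
  refine ⟨∑ k, (if G.Adj i k then 1 else 0) * (if G.Adj k j then 1 else 0), ?_⟩
  rw [sq, Matrix.mul_apply]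
  push_cast
  simp [adjMat]

lemma trace4 {n : ℕ} (G : SimpleGraph (Fin n)) :
    2 * ∑ i, (G.degree i : ℝ) ^ 2 - ∑ i, (G.degree i : ℝ) ≤ (adjMat G ^ 4).trace := by
  have h1 : (adjMat G ^ 4).trace = ∑ i, ∑ j, (adjMat G ^ 2) i j ^ 2 := by
    rw [show (4:ℕ) = 2 + 2 from rfl, pow_add, Matrix.trace]
    apply Finset.sum_congr rfl
    intro i _
    rw [Matrix.diag_apply, Matrix.mul_apply]
    apply Finset.sum_congr rfl
    intro j _
    have : (adjMat G ^ 2) j i = (adjMat G ^ 2) i j := by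
      simp only [sq, Matrix.mul_apply]
      apply Finset.sum_congr rfl
      intro k _
      rw [adjMat_comm G j k, adjMat_comm G k i, mul_comm]
    rw [this, ← sq]
  have h2 : ∑ i, ∑ j, (adjMat G ^ 2) i j = ∑ i, (G.degree i : ℝ) ^ 2 := by
    simp only [sq (adjMat G), Matrix.mul_apply]
    have : ∀ i, ∑ j, ∑ k, adjMat G i k * adjMat G k j = ∑ k, adjMat G i k * (G.degree k : ℝ) := by
      intro i
      rw [Finset.sum_comm]
      apply Finset.sum_congr rfl
      intro k _
      rw [← Finset.mul_sum, sum_row]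
    simp only [this]
    rw [Finset.sum_comm]
    apply Finset.sum_congr rfl
    intro k _
    rw [← Finset.sum_mul]
    simp only [adjMat_comm G _ k]
    rw [sum_row, sq]
  rw [h1]
  have h3 : ∀ i, (∑ j, (adjMat G ^ 2) i j) + (G.degree i : ℝ)^2 - (G.degree i : ℝ) ≤ ∑ j, (adjMat G ^ 2) i j ^ 2 := by
    intro i
    rw [← Finset.add_sum_erase _ _ (Finset.mem_univ i), ← Finset.add_sum_erase _ (fun j => (adjMat G ^ 2) i j ^ 2) (Finset.mem_univ i)]
    simp only [sq_diag]
    have : ∑ j ∈ Finset.univ.erase i, (adjMat G ^ 2) i j ≤ ∑ j ∈ Finset.univ.erase i, (adjMat G ^ 2) i j ^ 2 := by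
      apply Finset.sum_le_sum
      intro j _
      obtain ⟨k, hk⟩ := sq_nat G i j
      rw [hk]
      exact_mod_cast Nat.le_self_pow (by norm_num) k
    linarith
  have h4 := Finset.sum_le_sum (s := Finset.univ) (fun i _ => h3 i)
  rw [Finset.sum_sub_distrib, Finset.sum_add_distrib, h2] at h4
  linarith

lemma trace2 {n : ℕ} (G : SimpleGraph (Fin n)) :
    (adjMat G ^ 2).trace = ∑ i, (G.degree i : ℝ) := by
  simp [Matrix.trace, sq_diag]

lemma tree_roots_neg {n : ℕ} (T : SimpleGraph (Fin n)) (hT : T.IsTree) :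
    (Matrix.charpoly (adjMat T)).roots.map (fun x => -x) = (Matrix.charpoly (adjMat T)).roots := by
  obtain ⟨C⟩ := hT.isAcyclic.colorable_two
  apply roots_neg T (fun i => if C i = 0 then 1 else -1)
  · intro i; split_ifs <;> norm_num
  · intro i j hij
    have := C.valid hij
    by_cases h1 : C i = 0 <;> by_cases h2 : C j = 0 <;> simp [h1, h2]
    · exact (this (h1.trans h2.symm)).elim
    · exact (this (by omega)).elim

lemma spec_ineq {n : ℕ} (hn : 5 ≤ n) (T : SimpleGraph (Fin n)) (hT : T.IsTree) :
    ∃ r : ℝ, 0 ≤ r ∧ 0 ≤ lam 2 T ∧ lam 2 T ≤ lam 1 T ∧ lam 1 T ^ 2 + lam 2 T ^ 2 = (n - 1) - r ∧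
      2 * (lam 1 T ^ 2 * lam 2 T ^ 2) ≤ ((n:ℝ) - 1) ^ 2 - (∑ i, (T.degree i : ℝ) ^ 2 - (n - 1))
        - r * ((n - 1) + lam 1 T ^ 2) ∧
      ∀ c : ℝ, 0 ≤ c → 6 ≤ ((Matrix.charpoly (adjMat T)).roots.filter (fun x => c ≤ x ^ 2)).card → c ≤ r := by
  obtain ⟨M, hM, h21, h2, hMle⟩ := spec (by omega) T (tree_roots_neg T hT)
  have t2 := trace_pow_eq T 2
  have t4 := trace_pow_eq T 4
  have t4' := trace4 T
  rw [trace2, sum_deg T hT] at t2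
  rw [← t4, sum_deg T hT] at t4'
  rw [hM] at t2 t4'
  simp only [Multiset.insert_eq_cons, Multiset.map_add, Multiset.map_cons, Multiset.map_singleton, Multiset.sum_add, Multiset.sum_cons, Multiset.sum_singleton] at t2 t4'
  have hnn : 0 ≤ (M.map (fun x => x ^ 2)).sum := by
    apply Multiset.sum_nonneg
    intro x hx
    obtain ⟨y, _, rfl⟩ := Multiset.mem_map.1 hx
    positivity
  have h4 : (M.map (fun x => x ^ 4)).sum ≤ lam 2 T ^ 2 * (M.map (fun x => x ^ 2)).sum := by
    rw [← Multiset.sum_map_mul_left]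
    apply Multiset.sum_map_le_sum_map
    intro m hm
    have : m ^ 2 ≤ lam 2 T ^ 2 := sq_le_sq.2 (by rw [abs_of_nonneg h2]; exact hMle m hm)
    nlinarith [sq_nonneg m]
  refine ⟨(M.map (fun x => x ^ 2)).sum / 2, by positivity, h2, h21, by linarith, ?_, ?_⟩
  · generalize (M.map (fun x => x ^ 2)).sum = r at *
    generalize (M.map (fun x => x ^ 4)).sum = q at *
    have : r = 2 * ((n:ℝ) - 1) - 2 * (lam 1 T ^ 2 + lam 2 T ^ 2) := by linarith
    have e : (-lam 1 T)^4 = (lam 1 T^2)^2 := by ring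
    have e' : (-lam 2 T)^4 = (lam 2 T^2)^2 := by ring
    have e3 : (lam 1 T)^4 = (lam 1 T^2)^2 := by ring
    have e4 : (lam 2 T)^4 = (lam 2 T^2)^2 := by ring
    rw [e, e', e3, e4] at t4'
    generalize lam 1 T ^ 2 = x1 at *
    generalize lam 2 T ^ 2 = x2 at *
    generalize ∑ i, (T.degree i : ℝ) ^ 2 = Q at *
    generalize (n:ℝ) = N at *
    subst this
    nlinarith
  · intro c hc h6
    rw [hM, Multiset.filter_add, Multiset.card_add] at h6
    have h5 : 2 ≤ (M.filter (fun x => c ≤ x ^ 2)).card := by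
      have := Multiset.card_le_card (Multiset.filter_le (fun x => c ≤ x ^ 2) ({-lam 1 T, -lam 2 T, lam 2 T, lam 1 T} : Multiset ℝ))
      simp only [Multiset.insert_eq_cons, Multiset.card_cons, Multiset.card_singleton] at this h6
      omega
    have h7 : ((M.filter (fun x => c ≤ x ^ 2)).card : ℝ) * c ≤ ((M.filter (fun x => c ≤ x ^ 2)).map (fun x => x ^ 2)).sum := by
      rw [← nsmul_eq_mul, ← Multiset.card_map (fun x : ℝ => x ^ 2)]
      apply Multiset.card_nsmul_le_sum
      intro x hx
      obtain ⟨y, hy, rfl⟩ := Multiset.mem_map.1 hx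
      exact (Multiset.mem_filter.1 hy).2
    have h8 : ((M.filter (fun x => c ≤ x ^ 2)).map (fun x => x ^ 2)).sum ≤ (M.map (fun x => x ^ 2)).sum := by
      conv_rhs => rw [← Multiset.filter_add_not (fun x => c ≤ x ^ 2) M, Multiset.map_add, Multiset.sum_add]
      have : 0 ≤ ((M.filter (fun x => ¬ c ≤ x ^ 2)).map (fun x => x ^ 2)).sum := by
        apply Multiset.sum_nonneg
        intro x hx
        obtain ⟨y, _, rfl⟩ := Multiset.mem_map.1 hx
        positivity
      linarith
    have h9 : (2:ℝ) ≤ ((M.filter (fun x => c ≤ x ^ 2)).card : ℝ) := by exact_mod_cast h5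
    nlinarith


lemma dc_sum (a b : ℕ) (g : ℕ → ℝ) : ∑ j : Fin (a + b + 3), g j =
    g 0 + g 1 + g 2 + ∑ j ∈ Finset.range a, g (3 + j) + ∑ j ∈ Finset.range b, g (3 + a + j) := by
  rw [Fin.sum_univ_eq_sum_range, show a + b + 3 = 3 + a + b by ring, Finset.sum_range_add, Finset.sum_range_add]
  simp [Finset.sum_range_succ]

lemma dc_adj (a b : ℕ) (i j : Fin (a + b + 3)) : (doubleComet a b 3).Adj i j ↔
    (((i : ℕ) + 1 = (j : ℕ) ∧ (j : ℕ) < 3) ∨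
    (3 ≤ (i : ℕ) ∧ (i : ℕ) < 3 + a ∧ (j : ℕ) = 0) ∨
    (3 + a ≤ (i : ℕ) ∧ (j : ℕ) = 2)) ∨ (((j : ℕ) + 1 = (i : ℕ) ∧ (i : ℕ) < 3) ∨
    (3 ≤ (j : ℕ) ∧ (j : ℕ) < 3 + a ∧ (i : ℕ) = 0) ∨
    (3 + a ≤ (j : ℕ) ∧ (i : ℕ) = 2)) := by
  simp only [doubleComet, SimpleGraph.fromRel_adj, ne_eq, Fin.ext_iff]
  omega

lemma dc_root (a b : ℕ) (θ : ℝ) (hθ : 0 < θ) (h : (θ ^ 2 - a - 1) * (θ ^ 2 - b - 1) = 1) :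
    θ ∈ (Matrix.charpoly (adjMat (doubleComet a b 3))).roots := by
  set q : ℝ := θ ^ 2 - a - 1 with hq
  let f : ℕ → ℝ := fun i => if i = 0 then 1 else if i = 1 then (1 + q) / θ else if i = 2 then q
    else if i < 3 + a then 1 / θ else q / θ
  have f0 : f 0 = 1 := by simp [f]
  have f1 : f 1 = (1 + q) / θ := by simp [f]
  have f2 : f 2 = q := by simp [f]
  have f3 : ∀ j, j < a → f (3 + j) = 1 / θ := by 
    intro j hj
    simp only [f]
    rw [if_neg (by omega), if_neg (by omega), if_neg (by omega), if_pos (by omega)]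
  have f4 : ∀ j, f (3 + a + j) = q / θ := by 
    intro j
    simp only [f]
    rw [if_neg (by omega), if_neg (by omega), if_neg (by omega), if_neg (by omega)]
  have key : (adjMat (doubleComet a b 3)).mulVec (fun i => f i) = θ • (fun i : Fin (a+b+3) => f i) := by
    ext i
    simp only [Matrix.mulVec, dotProduct, adjMat, dc_adj, Pi.smul_apply, smul_eq_mul]
    rw [dc_sum a b (fun j => (if (((i : ℕ) + 1 = j ∧ j < 3) ∨
    (3 ≤ (i : ℕ) ∧ (i : ℕ) < 3 + a ∧ j = 0) ∨
    (3 + a ≤ (i : ℕ) ∧ j = 2)) ∨ ((j + 1 = (i : ℕ) ∧ (i : ℕ) < 3) ∨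
    (3 ≤ j ∧ j < 3 + a ∧ (i : ℕ) = 0) ∨
    (3 + a ≤ j ∧ (i : ℕ) = 2)) then 1 else 0) * f j)]
    obtain ⟨i, hi⟩ := i
    simp only [f4]
    have h3 : ∑ j ∈ Finset.range a, (if ((i + 1 = 3 + j ∧ 3 + j < 3) ∨ (3 ≤ i ∧ i < 3 + a ∧ 3 + j = 0) ∨ (3 + a ≤ i ∧ 3 + j = 2)) ∨
       ((3 + j + 1 = i ∧ i < 3) ∨ (3 ≤ 3 + j ∧ 3 + j < 3 + a ∧ i = 0) ∨ (3 + a ≤ 3 + j ∧ i = 2)) then (1:ℝ) else 0) * f (3 + j) = if i = 0 then a * (1 / θ) else 0 := by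
      rw [Finset.sum_congr rfl (g := fun j => if i = 0 then 1 / θ else 0)]
      · split_ifs <;> simp
      · intro j hj
        have hj := Finset.mem_range.1 hj
        rw [f3 j hj]
        by_cases h0 : i = 0
        · rw [if_pos (by omega), if_pos h0, one_mul]
        · rw [if_neg (by omega), if_neg h0, zero_mul]
    have h4 : ∑ j ∈ Finset.range b, (if ((i + 1 = 3 + a + j ∧ 3 + a + j < 3) ∨ (3 ≤ i ∧ i < 3 + a ∧ 3 + a + j = 0) ∨ (3 + a ≤ i ∧ 3 + a + j = 2)) ∨
       ((3 + a + j + 1 = i ∧ i < 3) ∨ (3 ≤ 3 + a + j ∧ 3 + a + j < 3 + a ∧ i = 0) ∨ (3 + a ≤ 3 + a + j ∧ i = 2)) then (1:ℝ) else 0) * (q / θ) = if i = 2 then b * (q / θ) else 0 := by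
      rw [Finset.sum_congr rfl (g := fun j => if i = 2 then q / θ else 0)]
      · split_ifs <;> simp
      · intro j hj
        by_cases h0 : i = 2
        · rw [if_pos (by omega), if_pos h0, one_mul]
        · rw [if_neg (by omega), if_neg h0, zero_mul]
    rw [h3, h4, f0, f1, f2]
    have hne := hθ.ne'
    by_cases i0 : i = 0
    · subst i0
      simp [f0]
      field_simp
      rw [hq]; ring
    by_cases i1 : i = 1
    · subst i1
      simp [f1]
      field_simp
    by_cases i2 : i = 2
    · subst i2
      have h32 : ¬ (3 + a ≤ 2) := by omega
      simp [f2, h32]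
      field_simp
      linarith
    by_cases i3 : i < 3 + a
    · have : f i = 1 / θ := by
        simp only [f]
        rw [if_neg (by omega), if_neg (by omega), if_neg (by omega), if_pos (by omega)]
      rw [this]
      rw [if_pos (by first | omega | (simp; omega)), if_neg (by first | omega | (simp; omega)), if_neg (by first | omega | (simp; omega)), if_neg (by first | omega | (simp; omega)), if_neg (by first | omega | (simp; omega))]
      field_simp
      try ring
    · have : f i = q / θ := by
        simp only [f]
        rw [if_neg (by omega), if_neg (by omega), if_neg (by omega), if_neg (by omega)]
      rw [this]
      rw [if_neg (by first | omega | (simp; omega)), if_neg (by first | omega | (simp; omega)), if_pos (by first | omega | (simp; omega)), if_neg (by first | omega | (simp; omega)), if_neg (by first | omega | (simp; omega))]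
      field_simp
      try ring
  rw [Polynomial.mem_roots (Matrix.charpoly_monic _).ne_zero, Polynomial.IsRoot.def, Matrix.eval_charpoly]
  apply Matrix.exists_mulVec_eq_zero_iff.1
  refine ⟨fun i => f i, ?_, ?_⟩
  · intro h0
    have := congrFun h0 ⟨0, by omega⟩
    simp [f0] at this
  · rw [Matrix.sub_mulVec, key]
    ext i
    simp [Matrix.scalar_apply, Matrix.mulVec_diagonal]

lemma lam_ge {n : ℕ} (hn : 2 ≤ n) (G : SimpleGraph (Fin n)) (θ1 θ2 : ℝ) (h12 : θ2 < θ1)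
    (h1 : θ1 ∈ (Matrix.charpoly (adjMat G)).roots) (h2 : θ2 ∈ (Matrix.charpoly (adjMat G)).roots) :
    θ1 ≤ lam 1 G ∧ θ2 ≤ lam 2 G := by
  have hL : ((eigList G : List ℝ) : Multiset ℝ) = (Matrix.charpoly (adjMat G)).roots := by
    simp [eigList]
  have hlen : (eigList G).length = n := by
    have := congrArg Multiset.card hL
    simpa [roots_card] using this
  have hsort : (eigList G).Pairwise (· ≤ ·) := Multiset.pairwise_sort _ _
  have l1 : lam 1 G = (eigList G).getD (n-1) 0 := rfl
  have l2 : lam 2 G = (eigList G).getD (n-2) 0 := rfl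
  rw [← hL, Multiset.mem_coe] at h1 h2
  rw [l1, l2]
  generalize eigList G = L at *
  have hmono : ∀ i j (hi : i < L.length) (hj : j < L.length), i ≤ j → L[i] ≤ L[j] := by
    intro i j hi hj hij
    rcases hij.lt_or_eq with h | h
    · exact List.pairwise_iff_getElem.1 hsort i j hi hj h
    · subst h; exact le_rfl
  obtain ⟨i, hi, e1⟩ := List.getElem_of_mem h1
  obtain ⟨j, hj, e2⟩ := List.getElem_of_mem h2
  have g1 : L.getD (n-1) 0 = L[n-1] := List.getD_eq_getElem _ _ _
  have g2 : L.getD (n-2) 0 = L[n-2] := List.getD_eq_getElem _ _ _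
  rw [g1, g2]
  have a1 := hmono i (n-1) hi (by omega) (by omega)
  refine ⟨by linarith, ?_⟩
  have : j ≤ n - 2 := by
    by_contra hc
    have : i ≤ j := by omega
    have := hmono i j hi hj this
    linarith
  have := hmono j (n-2) hj (by omega) this
  linarith

lemma dc_bound (a b : ℕ) (ha : 1 ≤ a) (S : ℝ) 
    (hS : S ^ 2 < a + b + 2 + 2 * √((a:ℝ) * b + a + b)) :
    S < lam 1 (doubleComet a b 3) + lam 2 (doubleComet a b 3) := by
  set s := √(((a:ℝ) - b) ^ 2 + 4) with hs
  have hs2 : s ^ 2 = ((a:ℝ) - b) ^ 2 + 4 := Real.sq_sqrt (by positivity)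
  have hs0 : 0 < s := Real.sqrt_pos.2 (by positivity)
  have ha' : (1:ℝ) ≤ a := by exact_mod_cast ha
  have hb' : (0:ℝ) ≤ b := by positivity
  have hlt : s < a + b + 2 := by
    apply lt_of_pow_lt_pow_left₀ 2 (by positivity)
    rw [hs2]; nlinarith
  have hx2 : 0 < ((a:ℝ) + b + 2 - s) / 2 := by linarith
  have hx1 : 0 < ((a:ℝ) + b + 2 + s) / 2 := by linarith
  have r1 := dc_root a b (√(((a:ℝ) + b + 2 + s) / 2)) (Real.sqrt_pos.2 hx1) (by
    rw [Real.sq_sqrt hx1.le]; nlinarith)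
  have r2 := dc_root a b (√(((a:ℝ) + b + 2 - s) / 2)) (Real.sqrt_pos.2 hx2) (by
    rw [Real.sq_sqrt hx2.le]; nlinarith)
  obtain ⟨k1, k2⟩ := lam_ge (by omega) (doubleComet a b 3) _ _ (Real.sqrt_lt_sqrt hx2.le (by linarith)) r1 r2
  refine lt_of_lt_of_le ?_ (add_le_add k1 k2)
  apply lt_of_pow_lt_pow_left₀ 2 (by positivity)
  have : (√((a + b + 2 + s) / 2) + √((a + b + 2 - s) / 2)) ^ 2 = (a + b + 2 + 2 * √((a:ℝ) * b + a + b)) := by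
    rw [add_sq, Real.sq_sqrt hx1.le, Real.sq_sqrt hx2.le, mul_assoc, ← Real.sqrt_mul hx1.le]
    have : ((a:ℝ) + b + 2 + s) / 2 * ((a + b + 2 - s) / 2) = a * b + a + b := by nlinarith
    rw [this]; ring
  rw [this]; exact hS


set_option maxHeartbeats 1000000 in
lemma quad (q12 q13 q23 s t u : ℝ) (x1 x2 x3 y1 y2 y3 : ℝ)
    (h1 : (q12 = 0 ∧ s = 0) ∨ (q12 = 1 ∧ s = 0) ∨ (q12 = 0 ∧ s = 1))
    (h2 : (q13 = 0 ∧ t = 0) ∨ (q13 = 1 ∧ t = 0) ∨ (q13 = 0 ∧ t = 1))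
    (h3 : (q23 = 0 ∧ u = 0) ∨ (q23 = 1 ∧ u = 0) ∨ (q23 = 0 ∧ u = 1))
    (h : (q12 = 0 ∧ s = 0) ∨ (q13 = 0 ∧ t = 0) ∨ (q23 = 0 ∧ u = 0)) :
    (19 / 100) * (x1 ^ 2 + x2 ^ 2 + x3 ^ 2 + y1 ^ 2 + y2 ^ 2 + y3 ^ 2) ≤
    y1 ^ 2 + (s * y1 + y2) ^ 2 + (t * y1 + u * y2 + y3) ^ 2 +
    (x1 + s * x2 + t * x3 + q12 * y2 + q13 * y3) ^ 2 + (x2 + u * x3 + q12 * y1 + q23 * y3) ^ 2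
    + (x3 + q13 * y1 + q23 * y2) ^ 2 := by
  rcases h with ⟨rfl, rfl⟩ | ⟨rfl, rfl⟩ | ⟨rfl, rfl⟩
  · rcases h2 with ⟨rfl, rfl⟩ | ⟨rfl, rfl⟩ | ⟨rfl, rfl⟩ <;> rcases h3 with ⟨rfl, rfl⟩ | ⟨rfl, rfl⟩ | ⟨rfl, rfl⟩
    · linarith [sq_nonneg (x1), sq_nonneg (x2), sq_nonneg (x3), sq_nonneg (y1), sq_nonneg (y2), sq_nonneg (y3)]
    · linarith [sq_nonneg (x1), sq_nonneg (x2 + (100/81) * y3), sq_nonneg (x3 + (100/81) * y2), sq_nonneg (y1), sq_nonneg (y2), sq_nonneg (y3)]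
    · linarith [sq_nonneg (x1), sq_nonneg (x2 + (100/81) * x3), sq_nonneg (x3), sq_nonneg (y1), sq_nonneg (y2 + (100/181) * y3), sq_nonneg (y3)]
    · linarith [sq_nonneg (x1 + (100/81) * y3), sq_nonneg (x2), sq_nonneg (x3 + (100/81) * y1), sq_nonneg (y1), sq_nonneg (y2), sq_nonneg (y3)]
    · linarith [sq_nonneg (x1 + (100/81) * y3), sq_nonneg (x2 + (100/81) * y3), sq_nonneg (x3 + (100/81) * y1 + (100/81) * y2), sq_nonneg (y1 + (-1900/4661) * y2), sq_nonneg (y2), sq_nonneg (y3)]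
    · linarith [sq_nonneg (x1 + (100/81) * y3), sq_nonneg (x2 + (100/81) * x3), sq_nonneg (x3 + (8100/4661) * y1), sq_nonneg (y1), sq_nonneg (y2 + (100/181) * y3), sq_nonneg (y3)]
    · linarith [sq_nonneg (x1 + (100/81) * x3), sq_nonneg (x2), sq_nonneg (x3), sq_nonneg (y1 + (100/181) * y3), sq_nonneg (y2), sq_nonneg (y3)]
    · linarith [sq_nonneg (x1 + (100/81) * x3), sq_nonneg (x2 + (100/81) * y3), sq_nonneg (x3 + (8100/4661) * y2), sq_nonneg (y1 + (100/181) * y3), sq_nonneg (y2), sq_nonneg (y3)]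
    · linarith [sq_nonneg (x1 + (100/81) * x3), sq_nonneg (x2 + (100/81) * x3), sq_nonneg (x3), sq_nonneg (y1 + (100/181) * y2 + (100/181) * y3), sq_nonneg (y2 + (100/281) * y3), sq_nonneg (y3)]
  · rcases h1 with ⟨rfl, rfl⟩ | ⟨rfl, rfl⟩ | ⟨rfl, rfl⟩ <;> rcases h3 with ⟨rfl, rfl⟩ | ⟨rfl, rfl⟩ | ⟨rfl, rfl⟩
    · linarith [sq_nonneg (x1), sq_nonneg (x2), sq_nonneg (x3), sq_nonneg (y1), sq_nonneg (y2), sq_nonneg (y3)]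
    · linarith [sq_nonneg (x1), sq_nonneg (x2 + (100/81) * y3), sq_nonneg (x3 + (100/81) * y2), sq_nonneg (y1), sq_nonneg (y2), sq_nonneg (y3)]
    · linarith [sq_nonneg (x1), sq_nonneg (x2 + (100/81) * x3), sq_nonneg (x3), sq_nonneg (y1), sq_nonneg (y2 + (100/181) * y3), sq_nonneg (y3)]
    · linarith [sq_nonneg (x1 + (100/81) * y2), sq_nonneg (x2 + (100/81) * y1), sq_nonneg (x3), sq_nonneg (y1), sq_nonneg (y2), sq_nonneg (y3)]
    · linarith [sq_nonneg (x1 + (100/81) * y2), sq_nonneg (x2 + (100/81) * y1 + (100/81) * y3), sq_nonneg (x3 + (100/81) * y2), sq_nonneg (y1 + (-1900/4661) * y3), sq_nonneg (y2), sq_nonneg (y3)]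
    · linarith [sq_nonneg (x1 + (100/81) * y2), sq_nonneg (x2 + (100/81) * x3 + (100/81) * y1), sq_nonneg (x3 + (-1900/4661) * y1), sq_nonneg (y1), sq_nonneg (y2 + (8100/12761) * y3), sq_nonneg (y3)]
    · linarith [sq_nonneg (x1 + (100/81) * x2), sq_nonneg (x2), sq_nonneg (x3), sq_nonneg (y1 + (100/181) * y2), sq_nonneg (y2), sq_nonneg (y3)]
    · linarith [sq_nonneg (x1 + (100/81) * x2), sq_nonneg (x2 + (8100/4661) * y3), sq_nonneg (x3 + (100/81) * y2), sq_nonneg (y1 + (100/181) * y2), sq_nonneg (y2), sq_nonneg (y3)]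
    · linarith [sq_nonneg (x1 + (100/81) * x2), sq_nonneg (x2 + (8100/4661) * x3), sq_nonneg (x3), sq_nonneg (y1 + (100/181) * y2), sq_nonneg (y2 + (18100/22761) * y3), sq_nonneg (y3)]
  · rcases h1 with ⟨rfl, rfl⟩ | ⟨rfl, rfl⟩ | ⟨rfl, rfl⟩ <;> rcases h2 with ⟨rfl, rfl⟩ | ⟨rfl, rfl⟩ | ⟨rfl, rfl⟩
    · linarith [sq_nonneg (x1), sq_nonneg (x2), sq_nonneg (x3), sq_nonneg (y1), sq_nonneg (y2), sq_nonneg (y3)]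
    · linarith [sq_nonneg (x1 + (100/81) * y3), sq_nonneg (x2), sq_nonneg (x3 + (100/81) * y1), sq_nonneg (y1), sq_nonneg (y2), sq_nonneg (y3)]
    · linarith [sq_nonneg (x1 + (100/81) * x3), sq_nonneg (x2), sq_nonneg (x3), sq_nonneg (y1 + (100/181) * y3), sq_nonneg (y2), sq_nonneg (y3)]
    · linarith [sq_nonneg (x1 + (100/81) * y2), sq_nonneg (x2 + (100/81) * y1), sq_nonneg (x3), sq_nonneg (y1), sq_nonneg (y2), sq_nonneg (y3)]
    · linarith [sq_nonneg (x1 + (100/81) * y2 + (100/81) * y3), sq_nonneg (x2 + (100/81) * y1), sq_nonneg (x3 + (100/81) * y1), sq_nonneg (y1), sq_nonneg (y2 + (-1900/4661) * y3), sq_nonneg (y3)]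
    · linarith [sq_nonneg (x1 + (100/81) * x3 + (100/81) * y2), sq_nonneg (x2 + (100/81) * y1), sq_nonneg (x3 + (-1900/4661) * y2), sq_nonneg (y1 + (8100/12761) * y3), sq_nonneg (y2), sq_nonneg (y3)]
    · linarith [sq_nonneg (x1 + (100/81) * x2), sq_nonneg (x2), sq_nonneg (x3), sq_nonneg (y1 + (100/181) * y2), sq_nonneg (y2), sq_nonneg (y3)]
    · linarith [sq_nonneg (x1 + (100/81) * x2 + (100/81) * y3), sq_nonneg (x2 + (-1900/4661) * y3), sq_nonneg (x3 + (100/81) * y1), sq_nonneg (y1 + (8100/12761) * y2), sq_nonneg (y2), sq_nonneg (y3)]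
    · linarith [sq_nonneg (x1 + (100/81) * x2 + (100/81) * x3), sq_nonneg (x2 + (-1900/4661) * x3), sq_nonneg (x3), sq_nonneg (y1 + (100/281) * y2 + (100/281) * y3), sq_nonneg (y2 + (-10000/12761) * y3), sq_nonneg (y3)]


lemma cyc3 {V : Type*} {G : SimpleGraph V} (h : G.IsAcyclic) {a b c : V} (h1 : G.Adj a b) (h2 : G.Adj b c)
    (h3 : G.Adj c a) : False := by
  refine h (SimpleGraph.Walk.cons h1 (.cons h2 (.cons h3 .nil))) ?_
  have := h1.ne; have := h2.ne; have := h3.ne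
  rw [SimpleGraph.Walk.isCycle_def, SimpleGraph.Walk.isTrail_def]
  simp
  grind

lemma cyc4 {V : Type*} {G : SimpleGraph V} (h : G.IsAcyclic) {a b c d : V} (h1 : G.Adj a b) (h2 : G.Adj b c)
    (h3 : G.Adj c d) (h4 : G.Adj d a) (n1 : a ≠ c) (n2 : b ≠ d) : False := by
  refine h (SimpleGraph.Walk.cons h1 (.cons h2 (.cons h3 (.cons h4 .nil)))) ?_
  have := h1.ne; have := h2.ne; have := h3.ne; have := h4.ne
  rw [SimpleGraph.Walk.isCycle_def, SimpleGraph.Walk.isTrail_def]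
  simp
  grind

lemma cyc5 {V : Type*} {G : SimpleGraph V} (h : G.IsAcyclic) {a b c d e : V} (h1 : G.Adj a b) (h2 : G.Adj b c)
    (h3 : G.Adj c d) (h4 : G.Adj d e) (h5 : G.Adj e a) (n1 : a ≠ c) (n2 : b ≠ d) (n3 : c ≠ e) (n4 : d ≠ a)
    (n5 : e ≠ b) : False := by
  refine h (SimpleGraph.Walk.cons h1 (.cons h2 (.cons h3 (.cons h4 (.cons h5 .nil))))) ?_
  have := h1.ne; have := h2.ne; have := h3.ne; have := h4.ne; have := h5.ne
  rw [SimpleGraph.Walk.isCycle_def, SimpleGraph.Walk.isTrail_def]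
  simp
  grind

lemma leaf_exists {V : Type*} [Fintype V] {G : SimpleGraph V} (h : G.IsAcyclic) {x y : V} (hxy : G.Adj x y) :
    ∃ l p, G.Adj l p ∧ ∀ z, G.Adj l z → z = p := by
  have hC := h.isTree_connectedComponent (G.connectedComponentMk x)
  have hx : x ∈ G.connectedComponentMk x := rfl
  have hy : y ∈ G.connectedComponentMk x := by
    show G.connectedComponentMk y = _
    exact SimpleGraph.ConnectedComponent.sound hxy.reachable.symm
  haveI : Nontrivial (G.connectedComponentMk x) :=
    ⟨⟨x, hx⟩, ⟨y, hy⟩, fun e => hxy.ne (congrArg Subtype.val e)⟩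
  obtain ⟨v, hv⟩ := hC.exists_vert_degree_one_of_nontrivial
  rw [SimpleGraph.degree_eq_one_iff_existsUnique_adj] at hv
  obtain ⟨p, hp, hu⟩ := hv
  refine ⟨v.1, p.1, hp, fun z hz => ?_⟩
  have hzC : z ∈ G.connectedComponentMk x := by
    have e : G.connectedComponentMk v.1 = _ := v.2
    show G.connectedComponentMk z = _
    rw [← e]
    exact SimpleGraph.ConnectedComponent.sound hz.reachable.symm
  have := hu ⟨z, hzC⟩ hz
  exact congrArg Subtype.val this

/-- Delete all edges at `p`. -/
def delV {V : Type*} (G : SimpleGraph V) (p : V) : SimpleGraph V where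
  Adj x y := G.Adj x y ∧ x ≠ p ∧ y ≠ p
  symm := ⟨fun x y h => ⟨h.1.symm, h.2.2, h.2.1⟩⟩
  loopless := ⟨fun x h => h.1.ne rfl⟩

lemma delV_le {V : Type*} (G : SimpleGraph V) (p : V) : delV G p ≤ G := fun _ _ h => h.1

lemma three_pairs {V : Type*} [Fintype V] {G : SimpleGraph V} (h : G.IsAcyclic) {x y : V} (hxy : x ≠ y)
    (hc : ∀ u v, u ≠ v → ∃ x y, G.Adj x y ∧ x ≠ u ∧ x ≠ v ∧ y ≠ u ∧ y ≠ v) :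
    ∃ l1 l2 l3 p1 p2 p3, G.Adj l1 p1 ∧ G.Adj l2 p2 ∧ G.Adj l3 p3 ∧ (∀ z, G.Adj l1 z → z = p1) ∧
      (∀ z, G.Adj l2 z → z = p1 ∨ z = p2) ∧ (∀ z, G.Adj l3 z → z = p1 ∨ z = p2 ∨ z = p3) ∧
      l2 ≠ p1 ∧ p2 ≠ p1 ∧ l3 ≠ p1 ∧ p3 ≠ p1 ∧ l3 ≠ p2 ∧ p3 ≠ p2 := by
  obtain ⟨_, _, e1, -⟩ := hc x y hxy
  obtain ⟨l1, p1, a1, u1⟩ := leaf_exists h e1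
  obtain ⟨x2, y2, e2, n1, n2, n3, n4⟩ := hc l1 p1 a1.ne
  have h2 : (delV G p1).IsAcyclic := h.anti (delV_le _ _)
  obtain ⟨l2, p2, a2, u2⟩ := leaf_exists h2 (x := x2) (y := y2) ⟨e2, n2, n4⟩
  obtain ⟨x3, y3, e3, m1, m2, m3, m4⟩ := hc p1 p2 a2.2.2.symm
  have h3 : (delV (delV G p1) p2).IsAcyclic := h2.anti (delV_le _ _)
  obtain ⟨l3, p3, a3, u3⟩ := leaf_exists h3 (x := x3) (y := y3) ⟨⟨e3, m1, m3⟩, m2, m4⟩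
  refine ⟨l1, l2, l3, p1, p2, p3, a1, a2.1, a3.1.1, u1, ?_, ?_, a2.2.1, a2.2.2, a3.1.2.1, a3.1.2.2,
    a3.2.1, a3.2.2⟩
  · intro z hz
    by_cases hp : z = p1
    · exact .inl hp
    · exact .inr (u2 z ⟨hz, a2.2.1, hp⟩)
  · intro z hz
    by_cases hp : z = p1
    · exact .inl hp
    by_cases hp2 : z = p2
    · exact .inr (.inl hp2)
    · exact .inr (.inr (u3 z ⟨⟨hz, a3.1.2.1, hp⟩, a3.2.1, hp2⟩))

lemma adjMat_val {n : ℕ} (G : SimpleGraph (Fin n)) (i j : Fin n) : 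
    (G.Adj i j ∧ adjMat G i j = 1) ∨ (¬ G.Adj i j ∧ adjMat G i j = 0) := by
  unfold adjMat
  by_cases h : G.Adj i j <;> simp [h]

lemma pair_aux {P R : Prop} {q s : ℝ} (h1 : (P ∧ q = 1) ∨ (¬ P ∧ q = 0)) (h2 : (R ∧ s = 1) ∨ (¬ R ∧ s = 0))
    (h : ¬ (P ∧ R)) : (q = 0 ∧ s = 0) ∨ (q = 1 ∧ s = 0) ∨ (q = 0 ∧ s = 1) := by
  rcases h1 with ⟨a, b⟩ | ⟨a, b⟩ <;> rcases h2 with ⟨c, d⟩ | ⟨c, d⟩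
  · exact absurd ⟨a, c⟩ h
  · exact .inr (.inl ⟨b, d⟩)
  · exact .inr (.inr ⟨b, d⟩)
  · exact .inl ⟨b, d⟩

lemma tri_aux {P R P' R' P'' R'' : Prop} {q s q' s' q'' s'' : ℝ}
    (h1 : (P ∧ q = 1) ∨ (¬ P ∧ q = 0)) (h2 : (R ∧ s = 1) ∨ (¬ R ∧ s = 0))
    (h1' : (P' ∧ q' = 1) ∨ (¬ P' ∧ q' = 0)) (h2' : (R' ∧ s' = 1) ∨ (¬ R' ∧ s' = 0))
    (h1'' : (P'' ∧ q'' = 1) ∨ (¬ P'' ∧ q'' = 0)) (h2'' : (R'' ∧ s'' = 1) ∨ (¬ R'' ∧ s'' = 0))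
    (h : ¬ ((P ∨ R) ∧ (P' ∨ R') ∧ (P'' ∨ R''))) :
    (q = 0 ∧ s = 0) ∨ (q' = 0 ∧ s' = 0) ∨ (q'' = 0 ∧ s'' = 0) := by
  have key : ∀ {P R : Prop} {q s : ℝ}, ((P ∧ q = 1) ∨ (¬ P ∧ q = 0)) → ((R ∧ s = 1) ∨ (¬ R ∧ s = 0)) →
      (P ∨ R) ∨ (q = 0 ∧ s = 0) := by
    intro P R q s a b
    rcases a with ⟨a, c⟩ | ⟨a, c⟩
    · exact .inl (.inl a)
    rcases b with ⟨b, d⟩ | ⟨b, d⟩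
    · exact .inl (.inr b)
    exact .inr ⟨c, d⟩
  rcases key h1 h2 with a | a
  · rcases key h1' h2' with b | b
    · rcases key h1'' h2'' with c | c
      · exact absurd ⟨a, b, c⟩ h
      · exact .inr (.inr c)
    · exact .inr (.inl b)
  · exact .inl a

lemma inj6 {V : Type*} {a b c d e f : V} (h : [a, b, c, d, e, f].Nodup) :
    Function.Injective ![a, b, c, d, e, f] := by
  have : ![a, b, c, d, e, f] = fun i : Fin 6 => [a, b, c, d, e, f].get i := by
    ext i; fin_cases i <;> rfl
  rw [this]
  exact List.nodup_iff_injective_get.1 h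

set_option maxHeartbeats 1000000 in
lemma six_roots {n : ℕ} (hn : 2 ≤ n) (G : SimpleGraph (Fin n)) (h : G.IsAcyclic)
    (hc : ∀ u v, u ≠ v → ∃ x y, G.Adj x y ∧ x ≠ u ∧ x ≠ v ∧ y ≠ u ∧ y ≠ v) :
    6 ≤ n ∧ 6 ≤ ((Matrix.charpoly (adjMat G)).roots.filter (fun x => (19 / 100 : ℝ) ≤ x^2)).card := by
  obtain ⟨l1, l2, l3, p1, p2, p3, a1, a2, a3, u1, u2, u3, n1, n2, n3, n4, n5, n6⟩ :=
    three_pairs h (x := (⟨0, by omega⟩ : Fin n)) (y := ⟨1, by omega⟩) (by simp) hc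
  have d1 := a1.ne
  have d2 := a2.ne
  have d3 := a3.ne
  have e1 : l1 ≠ l2 := by rintro rfl; exact n2 (u1 _ a2)
  have e2 : l1 ≠ l3 := by rintro rfl; exact n4 (u1 _ a3)
  have e3 : l1 ≠ p2 := by rintro rfl; exact n1 (u1 _ a2.symm)
  have e4 : l1 ≠ p3 := by rintro rfl; exact n3 (u1 _ a3.symm)
  have e5 : l2 ≠ l3 := by rintro rfl; have := u2 _ a3; tauto
  have e6 : l2 ≠ p3 := by rintro rfl; have := u2 _ a3.symm; tauto
  have na : ∀ z, z ≠ p1 → ¬ G.Adj l1 z := fun z hz hh => hz (u1 z hh)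
  have nb : ∀ z, z ≠ p1 → z ≠ p2 → ¬ G.Adj l2 z := fun z hz hz2 hh => by have := u2 z hh; tauto
  have b1 := na l2 n1
  have b2 := na l3 n3
  have b3 := na p2 n2
  have b4 := na p3 n4
  have b5 := nb l3 n3 n5
  have b6 := nb p3 n4 n6
  let e : Fin 6 → Fin n := ![l1, l2, l3, p1, p2, p3]
  have he : Function.Injective e := by
    apply inj6
    simp only [List.nodup_cons, List.mem_cons, List.not_mem_nil, or_false, not_or, not_false_eq_true, List.nodup_nil, and_true]
    exact ⟨⟨e1, e2, d1, e3, e4⟩, ⟨e5, n1, d2, e6⟩, ⟨n3, n5, d3⟩, ⟨n2.symm, n4.symm⟩, n6.symm⟩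
  refine ⟨by simpa using Fintype.card_le_of_injective e he, count_eig G (19/100) e he ?_⟩
  intro w
  have z0 : ∀ i, adjMat G i i = 0 := fun i => by simp [adjMat]
  have o1 : adjMat G l1 p1 = 1 := by simp [adjMat, a1]
  have o2 : adjMat G l2 p2 = 1 := by simp [adjMat, a2]
  have o3 : adjMat G l3 p3 = 1 := by simp [adjMat, a3]
  have c1 : adjMat G l1 l2 = 0 := by simp [adjMat, b1]
  have c2 : adjMat G l1 l3 = 0 := by simp [adjMat, b2]
  have c3 : adjMat G l1 p2 = 0 := by simp [adjMat, b3]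
  have c4 : adjMat G l1 p3 = 0 := by simp [adjMat, b4]
  have c5 : adjMat G l2 l3 = 0 := by simp [adjMat, b5]
  have c6 : adjMat G l2 p3 = 0 := by simp [adjMat, b6]
  have v1 := adjMat_val G p1 p2
  have v2 := adjMat_val G p1 p3
  have v3 := adjMat_val G p2 p3
  have v4 := adjMat_val G l2 p1
  have v5 := adjMat_val G l3 p1
  have v6 := adjMat_val G l3 p2
  have k1 : ¬ (G.Adj p1 p2 ∧ G.Adj l2 p1) := fun ⟨x, y⟩ => cyc3 h x a2.symm y
  have k2 : ¬ (G.Adj p1 p3 ∧ G.Adj l3 p1) := fun ⟨x, y⟩ => cyc3 h x a3.symm y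
  have k3 : ¬ (G.Adj p2 p3 ∧ G.Adj l3 p2) := fun ⟨x, y⟩ => cyc3 h x a3.symm y
  have t1 : ¬ (G.Adj p1 p2 ∧ G.Adj p1 p3 ∧ G.Adj p2 p3) := fun ⟨x, y, z⟩ => cyc3 h x z y.symm
  have t2 : ¬ (G.Adj p1 p2 ∧ G.Adj p1 p3 ∧ G.Adj l3 p2) := fun ⟨x, y, z⟩ =>
    cyc4 h x z.symm a3 y.symm n3.symm n6.symm
  have t3 : ¬ (G.Adj p1 p2 ∧ G.Adj l3 p1 ∧ G.Adj p2 p3) := fun ⟨x, y, z⟩ =>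
    cyc4 h x z a3.symm y n4.symm n5.symm
  have t4 : ¬ (G.Adj p1 p2 ∧ G.Adj l3 p1 ∧ G.Adj l3 p2) := fun ⟨x, y, z⟩ => cyc3 h x z.symm y
  have t5 : ¬ (G.Adj l2 p1 ∧ G.Adj p1 p3 ∧ G.Adj p2 p3) := fun ⟨x, y, z⟩ =>
    cyc4 h x.symm a2 z y.symm n2.symm e6
  have t6 : ¬ (G.Adj l2 p1 ∧ G.Adj p1 p3 ∧ G.Adj l3 p2) := fun ⟨x, y, z⟩ =>
    cyc5 h x.symm a2 z.symm a3 y.symm n2.symm e5 n6.symm n3 e6.symm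
  have t7 : ¬ (G.Adj l2 p1 ∧ G.Adj l3 p1 ∧ G.Adj p2 p3) := fun ⟨x, y, z⟩ =>
    cyc5 h x.symm a2 z a3.symm y n2.symm e6 n5.symm n4 e5.symm
  have t8 : ¬ (G.Adj l2 p1 ∧ G.Adj l3 p1 ∧ G.Adj l3 p2) := fun ⟨x, y, z⟩ =>
    cyc4 h x.symm a2 z.symm y n2.symm e5
  have Q := quad (adjMat G p1 p2) (adjMat G p1 p3) (adjMat G p2 p3) (adjMat G l2 p1) (adjMat G l3 p1)
    (adjMat G l3 p2) (w 0) (w 1) (w 2) (w 3) (w 4) (w 5)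
    (pair_aux v1 v4 k1) (pair_aux v2 v5 k2) (pair_aux v3 v6 k3) (tri_aux v1 v4 v2 v5 v3 v6 (by
      rintro ⟨x | x, y | y, z | z⟩
      exacts [t1 ⟨x, y, z⟩, t2 ⟨x, y, z⟩, t3 ⟨x, y, z⟩, t4 ⟨x, y, z⟩, t5 ⟨x, y, z⟩, t6 ⟨x, y, z⟩,
        t7 ⟨x, y, z⟩, t8 ⟨x, y, z⟩]))
  have sy := adjMat_comm G
  simp only [Fin.sum_univ_six]
  have E : ∀ i, e i = ![l1, l2, l3, p1, p2, p3] i := fun _ => rfl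
  simp only [show e 0 = l1 from rfl, show e 1 = l2 from rfl, show e 2 = l3 from rfl,
    show e 3 = p1 from rfl, show e 4 = p2 from rfl, show e 5 = p3 from rfl]
  simp only [sy l2 l1, sy l3 l1, sy p1 l1, sy p2 l1, sy p3 l1, sy l3 l2, sy p1 l2, sy p2 l2, sy p3 l2, sy p1 l3,
    sy p2 l3, sy p3 l3, sy p2 p1, sy p3 p1, sy p3 p2, z0, o1, o2, o3, c1, c2, c3, c4, c5, c6]
  refine Q.trans (le_of_eq ?_)
  ring


lemma deg_sq_ge {n : ℕ} (T : SimpleGraph (Fin n)) (i : Fin n) :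
    3 * (T.degree i : ℝ) - 2 ≤ (T.degree i : ℝ) ^ 2 := by
  generalize T.degree i = d
  have : (0 : ℤ) ≤ ((d : ℤ) - 1) * (d - 2) := by
    rcases le_or_gt d 1 with h | h
    · have : (d : ℤ) ≤ 1 := by exact_mod_cast h
      nlinarith
    · have : (2 : ℤ) ≤ d := by exact_mod_cast h
      nlinarith
  have : (0 : ℝ) ≤ ((d : ℝ) - 1) * (d - 2) := by exact_mod_cast this
  nlinarith

lemma ab_facts (n : ℕ) (hn : 5 ≤ n) : (n - 3) / 2 + (n - 2) / 2 + 3 = n ∧ 1 ≤ (n - 3) / 2 ∧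
    (n - 3) / 2 ≤ (n - 2) / 2 ∧ (n - 2) / 2 ≤ (n - 3) / 2 + 1 := by omega

set_option maxHeartbeats 1000000 in
lemma case2 {n : ℕ} (hn : 5 ≤ n) (T : SimpleGraph (Fin n)) (hT : T.IsTree) (a b : ℕ)
    (hab : a + b + 3 = n) (h1 : a ≤ b) (h2 : b ≤ a + 1)
    (hc : ∀ u v, u ≠ v → ∃ x y, T.Adj x y ∧ x ≠ u ∧ x ≠ v ∧ y ≠ u ∧ y ≠ v) :
    (lam 1 T + lam 2 T) ^ 2 < a + b + 2 + 2 * √((a : ℝ) * b + a + b) := by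
  obtain ⟨r, r0, l0, l12, hs, hp, hr⟩ := spec_ineq hn T hT
  obtain ⟨h6, hroots⟩ := six_roots (by omega) T hT.isAcyclic hc
  have hr := hr (19 / 100) (by norm_num) hroots
  have hN : (n : ℝ) = a + b + 3 := by rw [← hab]; push_cast; ring
  have hd : 6 * ((n : ℝ) - 1) - 2 * n ≤ ∑ i, (T.degree i : ℝ) ^ 2 := by
    have := Finset.sum_le_sum (fun i (_ : i ∈ Finset.univ) => deg_sq_ge T i)
    rw [Finset.sum_sub_distrib, ← Finset.mul_sum, sum_deg T hT] at this
    simp at this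
    linarith
  generalize lam 1 T = p at *
  generalize lam 2 T = q at *
  generalize ∑ i, (T.degree i : ℝ) ^ 2 = D at *
  set s := √((a : ℝ) * b + a + b) with hsd
  have s0 : 0 ≤ s := Real.sqrt_nonneg _
  have s2 : s ^ 2 = (a : ℝ) * b + a + b := Real.sq_sqrt (by positivity)
  have t0 : 0 ≤ p * q := mul_nonneg (l0.trans l12) l0
  have tle : 2 * (p * q) ≤ n - 1 - r := by nlinarith [sq_nonneg (p - q)]
  suffices 2 * (p * q) - r < 2 * s by nlinarith
  by_contra! hcon
  have e0 : 2 * s ≤ n - 1 - 2 * (19 / 100) := by linarith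
  rcases (show n = 6 ∨ n = 7 ∨ 8 ≤ n by omega) with h | h | h
  · have ha : a = 1 := by omega
    have hb : b = 2 := by omega
    subst ha hb h
    norm_num at *
    have t2 : 2 * (p * q) ^ 2 ≤ 12 - r * (5 + p ^ 2) := by nlinarith
    have px : (5 - r) / 2 ≤ p ^ 2 := by nlinarith
    have s22 : 2.2 ≤ s := by nlinarith
    have : (r + 2 * s) ^ 2 ≤ (2 * (p * q)) ^ 2 := by
      apply pow_le_pow_left₀ (by linarith); linarith
    nlinarith
  · have ha : a = 2 := by omega
    have hb : b = 2 := by omega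
    subst ha hb h
    norm_num at *
    nlinarith
  · have h8 : (8 : ℝ) ≤ n := by exact_mod_cast h
    have h2' : (b : ℝ) ≤ a + 1 := by exact_mod_cast h2
    have h1' : (a : ℝ) ≤ b := by exact_mod_cast h1
    have hsq : ((b : ℝ) - a) ^ 2 ≤ 1 := by
      have : 0 ≤ ((b : ℝ) - a) * (1 - (b - a)) := mul_nonneg (by linarith) (by linarith)
      linarith
    have h4 : (n - 1 : ℝ) ^ 2 - 5 ≤ 4 * s ^ 2 := by rw [s2, hN]; linarith
    have h5 : (2 * s) ^ 2 ≤ (n - 1 - 2 * (19 / 100)) ^ 2 := pow_le_pow_left₀ (by linarith) e0 2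
    linarith

lemma cover_deg {n : ℕ} (T : SimpleGraph (Fin n)) (hT : T.IsTree) (u v : Fin n) (huv : u ≠ v)
    (hc : ∀ x y, T.Adj x y → x = u ∨ x = v ∨ y = u ∨ y = v) :
    (T.degree u : ℝ) + T.degree v = n - 1 + adjMat T u v ∧
    ∑ i ∈ Finset.univ \ {u, v}, (T.degree i : ℝ) = n - 1 - adjMat T u v ∧
    ∑ i, (T.degree i : ℝ) ^ 2 = (T.degree u : ℝ) ^ 2 + (T.degree v : ℝ) ^ 2 +
      ∑ i ∈ Finset.univ \ {u, v}, (T.degree i : ℝ) ^ 2 := by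
  have split : ∀ f : Fin n → ℝ, ∑ i, f i = f u + f v + ∑ i ∈ Finset.univ \ {u, v}, f i := by
    intro f
    rw [← Finset.sum_sdiff (Finset.subset_univ {u, v}), Finset.sum_pair huv]
    ring
  have hd : ∀ i ∈ Finset.univ \ ({u, v} : Finset (Fin n)), (T.degree i : ℝ) = adjMat T i u + adjMat T i v := by
    intro i hi
    simp at hi
    rw [← sum_row, split, Finset.sum_eq_zero, add_zero]
    intro j hj
    simp at hj
    have : ¬ T.Adj i j := fun h => by have := hc i j h; tauto
    simp [adjMat, this]
  have hu : ∑ i, adjMat T i u = T.degree u := by simp_rw [adjMat_comm T _ u]; exact sum_row T u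
  have hv : ∑ i, adjMat T i v = T.degree v := by simp_rw [adjMat_comm T _ v]; exact sum_row T v
  have z0 : ∀ i, adjMat T i i = 0 := fun i => by simp [adjMat]
  have hs : ∑ i ∈ Finset.univ \ {u, v}, (T.degree i : ℝ) = T.degree u + T.degree v - 2 * adjMat T u v := by
    rw [Finset.sum_congr rfl hd, Finset.sum_add_distrib]
    have e1 := split (fun i => adjMat T i u)
    have e2 := split (fun i => adjMat T i v)
    simp only [hu, hv, z0, adjMat_comm T v u] at e1 e2
    linarith
  have ht := sum_deg T hT
  rw [split] at ht
  refine ⟨by linarith, by linarith, split _⟩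

lemma case1_adj {n : ℕ} (hn : 5 ≤ n) (T : SimpleGraph (Fin n)) (hT : T.IsTree) (a b : ℕ)
    (hab : a + b + 3 = n) (h1 : a ≤ b) (h2 : b ≤ a + 1) (u v : Fin n) (huv : T.Adj u v)
    (hc : ∀ x y, T.Adj x y → x = u ∨ x = v ∨ y = u ∨ y = v) :
    (lam 1 T + lam 2 T) ^ 2 < a + b + 2 + 2 * √((a : ℝ) * b + a + b) := by
  obtain ⟨r, r0, l0, l12, hs, hp, -⟩ := spec_ineq hn T hT
  obtain ⟨c1, c2, c3⟩ := cover_deg T hT u v huv.ne hc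
  have hA : adjMat T u v = 1 := by simp [adjMat, huv]
  rw [hA] at c1 c2
  have hd : ∑ i ∈ Finset.univ \ {u, v}, (T.degree i : ℝ) ≤ ∑ i ∈ Finset.univ \ {u, v}, (T.degree i : ℝ) ^ 2 := by
    apply Finset.sum_le_sum
    intro i _
    have : T.degree i ≤ T.degree i ^ 2 := Nat.le_self_pow (by norm_num) _
    exact_mod_cast this
  have hN : (n : ℝ) = a + b + 3 := by rw [← hab]; push_cast; ring
  have h2' : (b : ℝ) ≤ a + 1 := by exact_mod_cast h2
  have h1' : (a : ℝ) ≤ b := by exact_mod_cast h1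
  have h8 : (5 : ℝ) ≤ n := by exact_mod_cast hn
  generalize lam 1 T = p at *
  generalize lam 2 T = q at *
  have t0 : 0 ≤ p * q := mul_nonneg (l0.trans l12) l0
  have hsq : ((b : ℝ) - a) ^ 2 ≤ 1 := by
    have : 0 ≤ ((b : ℝ) - a) * (1 - (b - a)) := mul_nonneg (by linarith) (by linarith)
    linarith
  have rr : 0 ≤ r * ((n - 1) + p ^ 2) := mul_nonneg r0 (by nlinarith)
  suffices p * q < √((a : ℝ) * b + a + b) by nlinarith
  apply Real.lt_sqrt_of_sq_lt
  generalize (T.degree u : ℝ) = x at *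
  generalize (T.degree v : ℝ) = y at *
  have hy : y = n - x := by linarith
  subst hy
  have : (p * q) ^ 2 ≤ x * (n - x) - (n - 1) := by nlinarith
  have h4 : ((n : ℝ) - 1) ^ 2 - 5 ≤ 4 * ((a : ℝ) * b + a + b) := by rw [hN]; linarith
  nlinarith [sq_nonneg (2 * x - n)]

lemma case1_nonadj {n : ℕ} (hn : 5 ≤ n) (T : SimpleGraph (Fin n)) (hT : T.IsTree) (a b : ℕ)
    (hab : a + b + 3 = n) (h1 : a ≤ b) (u v : Fin n) (hne : u ≠ v) (huv : ¬ T.Adj u v)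
    (hc : ∀ x y, T.Adj x y → x = u ∨ x = v ∨ y = u ∨ y = v) (hle : T.degree u ≤ T.degree v)
    (h2 : b ≤ a + 1) :
    (lam 1 T + lam 2 T) ^ 2 < a + b + 2 + 2 * √((a : ℝ) * b + a + b) ∨ 
      (T.degree u = a + 1 ∧ T.degree v = b + 1) := by
  obtain ⟨r, r0, l0, l12, hs, hp, -⟩ := spec_ineq hn T hT
  obtain ⟨c1, c2, c3⟩ := cover_deg T hT u v hne hc
  have hA : adjMat T u v = 0 := by simp [adjMat, huv]
  rw [hA] at c1 c2
  have hd : 3 * ((n : ℝ) - 1) - 2 * (n - 2) ≤ ∑ i ∈ Finset.univ \ {u, v}, (T.degree i : ℝ) ^ 2 := by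
    have := Finset.sum_le_sum (fun i (_ : i ∈ Finset.univ \ ({u, v} : Finset (Fin n))) => deg_sq_ge T i)
    rw [Finset.sum_sub_distrib, ← Finset.mul_sum, c2] at this
    rw [Finset.sum_const, Finset.card_sdiff_of_subset (Finset.subset_univ _), Finset.card_pair hne, Finset.card_univ,
      Fintype.card_fin, nsmul_eq_mul, Nat.cast_sub (by omega)] at this
    push_cast at this
    linarith
  have hN : (n : ℝ) = a + b + 3 := by rw [← hab]; push_cast; ring
  have hdeg : T.degree u + T.degree v = a + b + 2 := by
    have : (T.degree u : ℝ) + T.degree v = a + b + 2 := by rw [c1, hN]; ring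
    exact_mod_cast this
  have h8 : (5 : ℝ) ≤ n := by exact_mod_cast hn
  generalize lam 1 T = p at *
  generalize lam 2 T = q at *
  generalize T.degree u = x at *
  generalize T.degree v = y at *
  by_cases hx : x = a + 1
  · right; omega
  left
  have hxa : x ≤ a := by omega
  have t0 : 0 ≤ p * q := mul_nonneg (l0.trans l12) l0
  have rr : 0 ≤ r * ((n - 1) + p ^ 2) := mul_nonneg r0 (by nlinarith)
  suffices p * q < √((a : ℝ) * b + a + b) by nlinarith
  apply Real.lt_sqrt_of_sq_lt
  have hxa' : (x : ℝ) ≤ a := by exact_mod_cast hxa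
  have h1' : (a : ℝ) ≤ b := by exact_mod_cast h1
  have hy : (y : ℝ) = a + b + 2 - x := by have : (x : ℝ) + y = a + b + 2 := by exact_mod_cast hdeg
                                          linarith
  have e : (p * q) ^ 2 ≤ (x : ℝ) * y - 1 := by
    have : ((n : ℝ) - 1) = x + y := by linarith
    nlinarith
  rw [hy] at e
  have : 0 < ((a : ℝ) + 1 - x) * (b + 1 - x) := mul_pos (by linarith) (by linarith)
  nlinarith


/-- Label adjacency pattern. -/
def labAdj (i j : ℕ) : Prop :=
  (i = 0 ∧ j = 1) ∨ (i = 1 ∧ j = 0) ∨ (i = 1 ∧ j = 2) ∨ (i = 2 ∧ j = 1) ∨ (i = 0 ∧ j = 3) ∨ (i = 3 ∧ j = 0) ∨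
  (i = 2 ∧ j = 4) ∨ (i = 4 ∧ j = 2)

/-- Labels of the double comet. -/
def dcLab (a : ℕ) (i : ℕ) : ℕ := if i < 3 then i else if i < 3 + a then 3 else 4

set_option maxHeartbeats 2000000 in
lemma dc_labAdj (a b : ℕ) (i j : Fin (a + b + 3)) :
    (doubleComet a b 3).Adj i j ↔ labAdj (dcLab a i) (dcLab a j) := by
  rw [dc_adj]
  have key : ∀ i : ℕ, (i < 3 ∧ dcLab a i = i) ∨ (3 ≤ i ∧ i < 3 + a ∧ dcLab a i = 3) ∨
      (3 + a ≤ i ∧ dcLab a i = 4) := by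
    intro i
    unfold dcLab
    split_ifs with h1 h2
    · exact .inl ⟨h1, rfl⟩
    · exact .inr (.inl ⟨by omega, h2, rfl⟩)
    · exact .inr (.inr ⟨by omega, rfl⟩)
  have k1 := key i
  have k2 := key j
  unfold labAdj
  generalize dcLab a i = x at *
  generalize dcLab a j = y at *
  clear key
  rcases k1 with ⟨h, rfl⟩ | ⟨h, h', rfl⟩ | ⟨h, rfl⟩ <;> rcases k2 with ⟨g, rfl⟩ | ⟨g, g', rfl⟩ | ⟨g, rfl⟩ <;>
    constructor <;> omega

lemma dc_card (a b k : ℕ) : Fintype.card {i : Fin (a + b + 3) // dcLab a i = k} =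
    if k < 3 then 1 else if k = 3 then a else if k = 4 then b else 0 := by
  rw [Fintype.card_subtype, Finset.card_filter]
  have : ((∑ i : Fin (a + b + 3), if dcLab a i = k then 1 else 0 : ℕ) : ℝ) =
      ((if k < 3 then 1 else if k = 3 then a else if k = 4 then b else 0 : ℕ) : ℝ) := by
    push_cast
    rw [dc_sum a b (fun j => if dcLab a j = k then (1 : ℝ) else 0)]
    have s1 : ∑ j ∈ Finset.range a, (if dcLab a (3 + j) = k then (1 : ℝ) else 0) = if k = 3 then (a : ℝ) else 0 := by
      rw [Finset.sum_congr rfl (g := fun j => if k = 3 then (1 : ℝ) else 0)]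
      · split_ifs <;> simp
      · intro j hj
        have := Finset.mem_range.1 hj
        have : dcLab a (3 + j) = 3 := by unfold dcLab; rw [if_neg (by omega), if_pos (by omega)]
        rw [this]; simp only [eq_comm]
    have s2 : ∑ j ∈ Finset.range b, (if dcLab a (3 + a + j) = k then (1 : ℝ) else 0) = if k = 4 then (b : ℝ) else 0 := by
      rw [Finset.sum_congr rfl (g := fun j => if k = 4 then (1 : ℝ) else 0)]
      · split_ifs <;> simp
      · intro j hj
        have : dcLab a (3 + a + j) = 4 := by unfold dcLab; rw [if_neg (by omega), if_neg (by omega)]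
        rw [this]; simp only [eq_comm]
    simp only [s1, s2, show dcLab a 0 = 0 from rfl, show dcLab a 1 = 1 from rfl, show dcLab a 2 = 2 from rfl]
    by_cases k0 : k = 0
    · subst k0; simp
    by_cases k1 : k = 1
    · subst k1; simp
    by_cases k2 : k = 2
    · subst k2; simp
    have : ¬ k < 3 := by omega
    simp only [this, Ne.symm k0, Ne.symm k1, Ne.symm k2, if_false]
    by_cases k3 : k = 3
    · subst k3; simp
    simp [k3]
  exact_mod_cast this

lemma iso_of_lab {n a b : ℕ} (T : SimpleGraph (Fin n)) (c : Fin n → ℕ)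
    (hadj : ∀ x y, T.Adj x y ↔ labAdj (c x) (c y))
    (hcard : ∀ k, (Finset.univ.filter (fun x => c x = k)).card =
      if k < 3 then 1 else if k = 3 then a else if k = 4 then b else 0) :
    Nonempty (T ≃g doubleComet a b 3) := by
  have E : ∀ k, Nonempty ({x : Fin n // c x = k} ≃ {i : Fin (a + b + 3) // dcLab a i = k}) := by
    intro k
    refine ⟨Fintype.equivOfCardEq ?_⟩
    rw [dc_card, Fintype.card_subtype, hcard]
  let e := Equiv.ofFiberEquiv (f := c) (g := fun i : Fin (a + b + 3) => dcLab a i) (fun k => (E k).some)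
  refine ⟨⟨e, ?_⟩⟩
  intro x y
  have hm : ∀ x, dcLab a (e x) = c x := fun x => Equiv.ofFiberEquiv_map (f := c) (g := fun i : Fin (a + b + 3) => dcLab a i) _ x
  show (doubleComet a b 3).Adj (e x) (e y) ↔ T.Adj x y
  rw [dc_labAdj, hm, hm, hadj]

lemma iso_exists {n : ℕ} (hn : 5 ≤ n) (T : SimpleGraph (Fin n)) (hT : T.IsTree) (a b : ℕ)
    (hab : a + b + 3 = n) (u v : Fin n) (hne : u ≠ v) (huv : ¬ T.Adj u v)
    (hc : ∀ x y, T.Adj x y → x = u ∨ x = v ∨ y = u ∨ y = v)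
    (hu : T.degree u = a + 1) (hv : T.degree v = b + 1) :
    Nonempty (T ≃g doubleComet a b 3) := by
  have hvu : ¬ T.Adj v u := fun h => huv h.symm
  have huu : ¬ T.Adj u u := T.irrefl
  have hvv : ¬ T.Adj v v := T.irrefl
  haveI : Nontrivial (Fin n) := ⟨u, v, hne⟩
  have hcov : ∀ x, x ≠ u → x ≠ v → T.Adj u x ∨ T.Adj v x := by
    intro x hxu hxv
    have hpos := hT.connected.preconnected.degree_pos_of_nontrivial x
    rw [T.degree_pos_iff_exists_adj] at hpos
    obtain ⟨y, hy⟩ := hpos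
    rcases hc x y hy with h | h | h | h
    · exact absurd h hxu
    · exact absurd h hxv
    · left; rw [← h]; exact hy.symm
    · right; rw [← h]; exact hy.symm
  have hun : T.neighborFinset u ∪ T.neighborFinset v = Finset.univ \ {u, v} := by
    ext x
    simp only [Finset.mem_union, SimpleGraph.mem_neighborFinset, Finset.mem_sdiff, Finset.mem_univ, true_and,
      Finset.mem_insert, Finset.mem_singleton, not_or]
    constructor
    · rintro (h | h)
      · exact ⟨h.ne.symm, fun e => huv (e ▸ h)⟩
      · exact ⟨fun e => hvu (e ▸ h), h.ne.symm⟩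
    · rintro ⟨h1, h2⟩; exact hcov x h1 h2
  have hcardu : (T.neighborFinset u ∪ T.neighborFinset v).card = n - 2 := by
    rw [hun, Finset.card_sdiff_of_subset (Finset.subset_univ _), Finset.card_pair hne, Finset.card_univ,
      Fintype.card_fin]
  have hint : (T.neighborFinset u ∩ T.neighborFinset v).card = 1 := by
    have := Finset.card_union_add_card_inter (T.neighborFinset u) (T.neighborFinset v)
    rw [hcardu, T.card_neighborFinset_eq_degree, T.card_neighborFinset_eq_degree, hu, hv] at this
    omega
  obtain ⟨w, hw⟩ := Finset.card_eq_one.1 hint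
  have hw' : ∀ x, T.Adj u x → T.Adj v x → x = w := by
    intro x h1 h2
    have : x ∈ T.neighborFinset u ∩ T.neighborFinset v := by simp [h1, h2]
    rw [hw] at this; simpa using this
  have hww : w ∈ T.neighborFinset u ∩ T.neighborFinset v := by rw [hw]; simp
  obtain ⟨wu, wv⟩ : T.Adj u w ∧ T.Adj v w := by simpa using hww
  have nwu := wu.ne
  have nwv := wv.ne
  let c : Fin n → ℕ := fun x => if x = u then 0 else if x = v then 2 else if x = w then 1 else
    if T.Adj u x then 3 else 4
  have cu : ∀ x, c x = 0 ↔ x = u := by intro x; simp only [c]; split_ifs <;> grind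
  have cv : ∀ x, c x = 2 ↔ x = v := by intro x; simp only [c]; split_ifs <;> grind
  have cw : ∀ x, c x = 1 ↔ x = w := by intro x; simp only [c]; split_ifs <;> grind
  have c3 : ∀ x, c x = 3 ↔ (T.Adj u x ∧ x ≠ w) := by
    intro x; simp only [c]; split_ifs <;> grind
  have c4 : ∀ x, c x = 4 ↔ (T.Adj v x ∧ x ≠ w) := by
    intro x
    have a1 := hcov x
    have a2 := hw' x
    simp only [c]; split_ifs <;> grind
  have c5 : ∀ x, c x < 5 := by intro x; simp only [c]; split_ifs <;> simp
  refine iso_of_lab T c ?_ ?_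
  · intro x y
    unfold labAdj
    simp only [cu, cv, cw, c3, c4]
    constructor
    · intro h
      rcases hc x y h with e | e | e | e
      · subst e; by_cases hy : y = w
        · exact .inl ⟨rfl, hy⟩
        · exact .inr (.inr (.inr (.inr (.inl ⟨rfl, h, hy⟩))))
      · subst e; by_cases hy : y = w
        · exact .inr (.inr (.inr (.inl ⟨rfl, hy⟩)))
        · exact .inr (.inr (.inr (.inr (.inr (.inr (.inl ⟨rfl, h, hy⟩))))))
      · subst e; by_cases hy : x = w
        · exact .inr (.inl ⟨hy, rfl⟩)
        · exact .inr (.inr (.inr (.inr (.inr (.inl ⟨⟨h.symm, hy⟩, rfl⟩)))))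
      · subst e; by_cases hy : x = w
        · exact .inr (.inr (.inl ⟨hy, rfl⟩))
        · exact .inr (.inr (.inr (.inr (.inr (.inr (.inr ⟨⟨h.symm, hy⟩, rfl⟩))))))
    · rintro (⟨rfl, rfl⟩ | ⟨rfl, rfl⟩ | ⟨rfl, rfl⟩ | ⟨rfl, rfl⟩ | ⟨rfl, h, -⟩ | ⟨⟨h, -⟩, rfl⟩ | ⟨rfl, h, -⟩ | ⟨⟨h, -⟩, rfl⟩)
      exacts [wu, wu.symm, wv.symm, wv, h, h.symm, h, h.symm]
  · intro k
    have f3 : Finset.univ.filter (fun x => c x = 3) = (T.neighborFinset u).erase w := by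
      ext x; simp [c3, and_comm]
    have f4 : Finset.univ.filter (fun x => c x = 4) = (T.neighborFinset v).erase w := by
      ext x; simp [c4, and_comm]
    rcases (show k = 0 ∨ k = 1 ∨ k = 2 ∨ k = 3 ∨ k = 4 ∨ 5 ≤ k by omega) with rfl | rfl | rfl | rfl | rfl | h
    · simp [cu, Finset.filter_eq']
    · simp [cw, Finset.filter_eq']
    · simp [cv, Finset.filter_eq']
    · rw [f3, Finset.card_erase_of_mem (by simpa using wu), T.card_neighborFinset_eq_degree, hu]; simp
    · rw [f4, Finset.card_erase_of_mem (by simpa using wv), T.card_neighborFinset_eq_degree, hv]; simp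
    · rw [if_neg (by omega), if_neg (by omega), if_neg (by omega), Finset.card_eq_zero,
        Finset.filter_eq_empty_iff]
      intro x _ hx
      have := c5 x
      omega

/-- For every `n ≥ 5`, the double comet `DC(⌊(n-3)/2⌋, ⌈(n-3)/2⌉, 3)` is the unique
maximizer of `λ₁ + λ₂` among trees on `n` vertices. -/
theorem spectral_sum_max_trees (n : ℕ) (hn : 5 ≤ n)
    (T : SimpleGraph (Fin n)) (hT : T.IsTree)
    (hiso : ¬ Nonempty (T ≃g doubleComet ((n - 3) / 2) ((n - 2) / 2) 3)) :
    lam 1 T + lam 2 T <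
      lam 1 (doubleComet ((n - 3) / 2) ((n - 2) / 2) 3) +
      lam 2 (doubleComet ((n - 3) / 2) ((n - 2) / 2) 3) := by
  obtain ⟨hab, ha, h1, h2⟩ := ab_facts n hn
  generalize (n - 3) / 2 = a at *
  generalize (n - 2) / 2 = b at *
  apply dc_bound a b ha
  by_cases hc : ∀ u v, u ≠ v → ∃ x y, T.Adj x y ∧ x ≠ u ∧ x ≠ v ∧ y ≠ u ∧ y ≠ v
  · exact case2 hn T hT a b hab h1 h2 hc
  have hc' : ∃ u v, u ≠ v ∧ ∀ x y, T.Adj x y → x = u ∨ x = v ∨ y = u ∨ y = v := by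
    by_contra hcon
    apply hc
    intro u v huv
    by_contra h
    refine hcon ⟨u, v, huv, fun x y hxy => ?_⟩
    by_contra h'
    simp only [not_or] at h'
    exact h ⟨x, y, hxy, h'⟩
  obtain ⟨u, v, huv, hcov⟩ := hc'
  by_cases hadj : T.Adj u v
  · exact case1_adj hn T hT a b hab h1 h2 u v hadj hcov
  rcases le_total (T.degree u) (T.degree v) with hle | hle
  · rcases case1_nonadj hn T hT a b hab h1 u v huv hadj hcov hle h2 with h | ⟨h, h'⟩
    · exact h
    · exact absurd (iso_exists hn T hT a b hab u v huv hadj hcov h h') hiso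
  · have hcov' : ∀ x y, T.Adj x y → x = v ∨ x = u ∨ y = v ∨ y = u := fun x y h => by
      have := hcov x y h; tauto
    have hadj' : ¬ T.Adj v u := fun h => hadj h.symm
    rcases case1_nonadj hn T hT a b hab h1 v u huv.symm hadj' hcov' hle h2 with h | ⟨h, h'⟩
    · exact h
    · exact absurd (iso_exists hn T hT a b hab v u huv.symm hadj' hcov' h h') hiso
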